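/- arXiv:1408.6751 — 3 statements merged into one kernel-verified Lean document; each statement's English description precedes it below -/
import Mathlib

section
/- Let m be an odd natural number with m ≥ 3, and let λ : Fin m → ℝ be a function that is not identically zero and satisfies ∑ i, λ i = 0. Define f : ℂ^m → ℝ by f(z) = ∑ i, λ i * ‖z i‖². Then there is no real constant c such that Δ(f²) = c · Δ(r⁴) as functions on ℂ^m, where r(z)² = ∑ i, ‖z i‖²; i.e., the Laplacian of f² is not a real scalar multiple of the Laplacian of the fourth power of the norm. -/
open MeasureTheory Finset

/-- Second directional derivative of `u` at `z` in direction `d`. -/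
noncomputable def dirDeriv2 {E : Type*} [NormedAddCommGroup E] [NormedSpace ℝ E]
    (u : E → ℝ) (z d : E) : ℝ :=
  fderiv ℝ (fun y => fderiv ℝ u y d) z d

/-- Euclidean Laplacian on `ℂ^m ≅ ℝ^{2m}`:
`Δu = ∑_j (∂²u/∂x_j² + ∂²u/∂y_j²)`, where `z_j = x_j + i y_j`. -/
noncomputable def laplacianC (m : ℕ) (u : EuclideanSpace ℂ (Fin m) → ℝ)
    (z : EuclideanSpace ℂ (Fin m)) : ℝ :=
  ∑ j : Fin m,
    (dirDeriv2 u z (EuclideanSpace.single j (1 : ℂ)) +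
     dirDeriv2 u z (EuclideanSpace.single j Complex.I))

lemma hasFDerivAt_sum_mul_norm_sq {m : ℕ} (μ : Fin m → ℝ) (z : EuclideanSpace ℂ (Fin m)) :
    HasFDerivAt (fun z : EuclideanSpace ℂ (Fin m) => ∑ i, μ i * ‖z i‖ ^ 2)
      (∑ i, μ i • (2 • (innerSL ℝ (z i)).comp
        (PiLp.proj (𝕜 := ℝ) 2 (fun _ : Fin m => ℂ) i))) z := by
  refine HasFDerivAt.fun_sum fun i _ => HasFDerivAt.const_mul ?_ (μ i)
  exact ((PiLp.proj (𝕜 := ℝ) 2 (fun _ : Fin m => ℂ) i).hasFDerivAt (x := z)).norm_sq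

lemma hasFDerivAt_sum_mul_inner {m : ℕ} (μ : Fin m → ℝ) (z d : EuclideanSpace ℂ (Fin m)) :
    HasFDerivAt (fun z : EuclideanSpace ℂ (Fin m) => ∑ i, μ i * inner ℝ (d i) (z i))
      (∑ i, μ i • (innerSL ℝ (d i)).comp (PiLp.proj (𝕜 := ℝ) 2 (fun _ : Fin m => ℂ) i)) z := by
  refine HasFDerivAt.fun_sum fun i _ => HasFDerivAt.const_mul ?_ (μ i)
  exact ((innerSL ℝ (d i)).comp (PiLp.proj (𝕜 := ℝ) 2 (fun _ : Fin m => ℂ) i)).hasFDerivAt (x := z)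

lemma fderiv_sq_sum_mul_norm_sq {m : ℕ} (μ : Fin m → ℝ) (z d : EuclideanSpace ℂ (Fin m)) :
    fderiv ℝ (fun z : EuclideanSpace ℂ (Fin m) => (∑ i, μ i * ‖z i‖ ^ 2) ^ 2) z d =
      4 * ((∑ i, μ i * ‖z i‖ ^ 2) * ∑ i, μ i * inner ℝ (d i) (z i)) := by
  rw [((hasFDerivAt_sum_mul_norm_sq μ z).pow 2).fderiv]
  have h : ∑ i, μ i * (2 * inner ℝ (z i) (d i)) = 2 * ∑ i, μ i * inner ℝ (d i) (z i) := by
    rw [Finset.mul_sum]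
    exact Finset.sum_congr rfl fun i _ => by rw [real_inner_comm]; ring
  simp [-Complex.inner, h]
  ring

lemma dirDeriv2_sq_sum_mul_norm_sq {m : ℕ} (μ : Fin m → ℝ) (z d : EuclideanSpace ℂ (Fin m)) :
    dirDeriv2 (fun z : EuclideanSpace ℂ (Fin m) => (∑ i, μ i * ‖z i‖ ^ 2) ^ 2) z d =
      8 * (∑ i, μ i * inner ℝ (d i) (z i)) ^ 2 +
        4 * (∑ i, μ i * ‖z i‖ ^ 2) * ∑ i, μ i * ‖d i‖ ^ 2 := by
  unfold dirDeriv2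
  simp_rw [fderiv_sq_sum_mul_norm_sq]
  rw [(((hasFDerivAt_sum_mul_norm_sq μ z).fun_mul (hasFDerivAt_sum_mul_inner μ z d)).const_mul
    4).fderiv]
  have h : ∑ i, μ i * (2 * inner ℝ (z i) (d i)) = 2 * ∑ i, μ i * inner ℝ (d i) (z i) := by
    rw [Finset.mul_sum]
    exact Finset.sum_congr rfl fun i _ => by rw [real_inner_comm]; ring
  simp [-Complex.inner, h]
  ring

lemma laplacianC_sq_sum_mul_norm_sq {m : ℕ} (μ : Fin m → ℝ) (z : EuclideanSpace ℂ (Fin m)) :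
    laplacianC m (fun z => (∑ i, μ i * ‖z i‖ ^ 2) ^ 2) z =
      8 * (∑ i, μ i) * (∑ i, μ i * ‖z i‖ ^ 2) + 8 * ∑ i, μ i ^ 2 * ‖z i‖ ^ 2 := by
  have key (w : ℂ) (j : Fin m) :
      dirDeriv2 (fun z : EuclideanSpace ℂ (Fin m) => (∑ i, μ i * ‖z i‖ ^ 2) ^ 2) z
        (EuclideanSpace.single j w) =
      8 * (μ j * inner ℝ w (z j)) ^ 2 + 4 * (∑ i, μ i * ‖z i‖ ^ 2) * (μ j * ‖w‖ ^ 2) := by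
    rw [dirDeriv2_sq_sum_mul_norm_sq]
    congr 3
    · rw [Finset.sum_eq_single j] <;> simp +contextual
    · rw [Finset.sum_eq_single j] <;> simp +contextual
  have hz (j : Fin m) : ‖z j‖ ^ 2 = (z j).re ^ 2 + (z j).im ^ 2 := by
    rw [← Complex.normSq_eq_norm_sq, Complex.normSq_apply]; ring
  unfold laplacianC
  simp_rw [key]
  generalize ∑ i, μ i * ‖z i‖ ^ 2 = Q
  rw [mul_right_comm, Finset.mul_sum, Finset.mul_sum, ← Finset.sum_add_distrib]
  refine Finset.sum_congr rfl fun j _ => ?_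
  rw [hz j]
  simp [Complex.inner]
  ring

lemma laplacianC_norm_pow_four {m : ℕ} (z : EuclideanSpace ℂ (Fin m)) :
    laplacianC m (fun z => ‖z‖ ^ 4) z = 8 * (m + 1) * ‖z‖ ^ 2 := by
  have h : (fun z : EuclideanSpace ℂ (Fin m) => ‖z‖ ^ 4) =
      fun z => (∑ i, (fun _ => 1 : Fin m → ℝ) i * ‖z i‖ ^ 2) ^ 2 := by
    funext z
    simp only [one_mul, ← EuclideanSpace.norm_sq_eq]
    ring
  rw [h, laplacianC_sq_sum_mul_norm_sq]
  simp only [one_mul, one_pow, ← EuclideanSpace.norm_sq_eq]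
  simp
  ring

/-- An odd number of reals with the same square can only sum to zero if they all vanish. -/
lemma eq_zero_of_odd_of_sum_eq_zero {m : ℕ} (hodd : Odd m) (x : Fin m → ℝ) (b : ℝ)
    (hx : ∀ i, x i ^ 2 = b) (hsum : ∑ i, x i = 0) : x = 0 := by
  by_contra hne
  obtain ⟨k, hk⟩ := Function.ne_iff.mp hne
  have hs (i : Fin m) : ∃ s : ℤ, x i = s * x k ∧ (s : ZMod 2) = 1 := by
    rcases sq_eq_sq_iff_eq_or_eq_neg.mp ((hx i).trans (hx k).symm) with h | h
    · exact ⟨1, by rw [h]; simp, by simp⟩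
    · exact ⟨-1, by rw [h]; simp, by decide⟩
  choose s hs hs' using hs
  have h0 : ∑ i, s i = 0 := by
    rw [Finset.sum_congr rfl fun i _ => hs i, ← Finset.sum_mul] at hsum
    exact_mod_cast (mul_eq_zero.mp hsum).resolve_right hk
  have h1 := congrArg (Int.cast : ℤ → ZMod 2) h0
  have h2 : (m : ZMod 2) = 1 := hodd.natCast_zmod_two
  simp [hs', h2] at h1

/-- For odd `m ≥ 3` and a nonzero zero-sum tuple `λ`, the Laplacian of
`f² = (∑ i, λ i ‖z i‖²)²` is not a real multiple of the Laplacian of `r⁴ = ‖z‖⁴`. -/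
theorem stmt0 (m : ℕ) (hodd : Odd m) (hm : 3 ≤ m) (lam : Fin m → ℝ)
    (hne : lam ≠ 0) (hsum : ∑ i, lam i = 0) :
    ¬ ∃ c : ℝ, ∀ z : EuclideanSpace ℂ (Fin m),
        laplacianC m (fun z => (∑ i, lam i * ‖z i‖ ^ 2) ^ 2) z =
          c * laplacianC m (fun z => ‖z‖ ^ 4) z := by
  rintro ⟨c, hc⟩
  refine hne (eq_zero_of_odd_of_sum_eq_zero hodd lam (c * (m + 1)) (fun i => ?_) hsum)
  have h := hc (EuclideanSpace.single i 1)
  rw [laplacianC_sq_sum_mul_norm_sq, laplacianC_norm_pow_four, hsum,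
    Finset.sum_eq_single (s := Finset.univ) (f := fun j => lam j ^ 2 * _) i] at h
  · simp at h
    linarith
  · simp +contextual
  · simp
end

section
/- Let m be an odd natural number with m ≥ 3, and let λ : Fin m → ℝ be a function that is not identically zero and satisfies ∑ i, λ i = 0. Define f : ℂ^m → ℝ by f(z) = ∑ i, λ i * ‖z i‖². Then there do not exist a harmonic function h : ℂ^m → ℝ (a twice continuously differentiable function with Δh = 0 identically) and a real constant c such that f(z)² = h(z) + c * ‖z‖⁴ for all z ∈ ℂ^m. -/
open MeasureTheory Finset

/-- The second directional derivative of a `C²` function is the second derivative of its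
restriction to a line. -/
lemma dirDeriv2_eq_of_hasDerivAt {E : Type*} [NormedAddCommGroup E] [NormedSpace ℝ E]
    {u : E → ℝ} (hu : ContDiff ℝ 2 u) (z d : E) {p p' : ℝ → ℝ} {p'' : ℝ}
    (hp : ∀ t : ℝ, u (z + t • d) = p t) (hp' : ∀ t, HasDerivAt p (p' t) t)
    (hp'' : HasDerivAt p' p'' 0) : dirDeriv2 u z d = p'' := by
  have line : ∀ t : ℝ, HasDerivAt (fun t : ℝ => z + t • d) d t := fun t => by
    simpa using ((hasDerivAt_id t).smul_const d).const_add z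
  have first : ∀ t : ℝ, fderiv ℝ u (z + t • d) d = p' t := fun t => by
    have h1 := (hu.differentiable (by norm_num) (z + t • d)).hasFDerivAt.comp_hasDerivAt t (line t)
    have h2 : u ∘ (fun t : ℝ => z + t • d) = p := funext hp
    rw [h2] at h1
    exact h1.unique (hp' t)
  have hd : Differentiable ℝ (fun y => fderiv ℝ u y d) :=
    ((hu.fderiv_right (m := 1) (by norm_num)).clm_apply contDiff_const).differentiable (by norm_num)
  have h1 := (hd (z + (0 : ℝ) • d)).hasFDerivAt.comp_hasDerivAt 0 (line 0)
  have h2 : (fun y => fderiv ℝ u y d) ∘ (fun t : ℝ => z + t • d) = p' := funext first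
  rw [h2] at h1
  simpa [dirDeriv2] using h1.unique hp''

/-- The second directional derivative of a function which along the line `z + t d` is a
linear combination of squares of quadratic polynomials. -/
lemma dirDeriv2_eq_of_quartic {E : Type*} [NormedAddCommGroup E] [NormedSpace ℝ E]
    {u : E → ℝ} (hu : ContDiff ℝ 2 u) (z d : E) (a₀ a₁ a₂ b₀ b₁ b₂ c : ℝ)
    (hp : ∀ t : ℝ, u (z + t • d) =
      (a₀ + a₁ * t + a₂ * t ^ 2) ^ 2 - c * (b₀ + b₁ * t + b₂ * t ^ 2) ^ 2) :
    dirDeriv2 u z d = 2 * (a₁ ^ 2 + 2 * a₀ * a₂) - 2 * c * (b₁ ^ 2 + 2 * b₀ * b₂) := by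
  have hq : ∀ x₀ x₁ x₂ t : ℝ,
      HasDerivAt (fun t : ℝ => x₀ + x₁ * t + x₂ * t ^ 2) (x₁ + 2 * x₂ * t) t := fun x₀ x₁ x₂ t => by
    refine ((((hasDerivAt_id t).const_mul x₁).const_add x₀).add
      (((hasDerivAt_id t).pow 2).const_mul x₂)).congr_deriv ?_
    simp; ring
  have hl : ∀ x₁ x₂ t : ℝ, HasDerivAt (fun t : ℝ => x₁ + 2 * x₂ * t) (2 * x₂) t :=
    fun x₁ x₂ t => by
      simpa using ((hasDerivAt_id t).const_mul (2 * x₂)).const_add x₁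
  refine dirDeriv2_eq_of_hasDerivAt hu z d hp
    (p' := fun t => 2 * ((a₀ + a₁ * t + a₂ * t ^ 2) * (a₁ + 2 * a₂ * t)) -
      c * (2 * ((b₀ + b₁ * t + b₂ * t ^ 2) * (b₁ + 2 * b₂ * t)))) (fun t => ?_) ?_
  · refine (((hq a₀ a₁ a₂ t).pow 2).sub (((hq b₀ b₁ b₂ t).pow 2).const_mul c)).congr_deriv ?_
    simp; ring
  · refine ((((hq a₀ a₁ a₂ 0).mul (hl a₁ a₂ 0)).const_mul 2).sub
      ((((hq b₀ b₁ b₂ 0).mul (hl b₁ b₂ 0)).const_mul 2).const_mul c)).congr_deriv ?_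
    simp; ring

lemma sum_mul_norm_sq_add_smul {m : ℕ} (w : Fin m → ℝ) (z d : EuclideanSpace ℂ (Fin m)) (t : ℝ) :
    ∑ i, w i * ‖(z + t • d) i‖ ^ 2 =
      ∑ i, w i * ‖z i‖ ^ 2 + (2 * ∑ i, w i * inner ℝ (z i) (d i)) * t +
        (∑ i, w i * ‖d i‖ ^ 2) * t ^ 2 := by
  simp only [Finset.mul_sum, Finset.sum_mul, ← Finset.sum_add_distrib]
  refine Finset.sum_congr rfl fun i _ => ?_
  rw [PiLp.add_apply, PiLp.smul_apply, norm_add_sq_real, norm_smul, inner_smul_right, mul_pow,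
    Real.norm_eq_abs, sq_abs]
  ring

/-- Weights whose squares all agree, indexed by a type of odd cardinality, vanish as soon as
their sum does. -/
lemma eq_zero_of_sq_eq_of_sum_eq_zero {ι : Type*} [Fintype ι] (hodd : Odd (Fintype.card ι))
    {w : ι → ℝ} {a : ℝ} (hw : ∀ i, w i ^ 2 = a) (hsum : ∑ i, w i = 0) : w = 0 := by
  funext k
  have hs : ∀ i, ∃ s : ℤ, w i = s * w k ∧ (s : ZMod 2) = 1 := fun i => by
    rcases sq_eq_sq_iff_eq_or_eq_neg.1 ((hw i).trans (hw k).symm) with h | h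
    · exact ⟨1, by simp [h], by simp⟩
    · exact ⟨-1, by simp [h], by decide⟩
  choose s hs hs' using hs
  have hprod : ((∑ i, s i : ℤ) : ℝ) * w k = 0 := by
    rw [← hsum, Int.cast_sum, Finset.sum_mul]
    exact Finset.sum_congr rfl fun i _ => (hs i).symm
  rcases mul_eq_zero.1 hprod with h | h
  · have h0 : ((∑ i, s i : ℤ) : ZMod 2) = 0 := by
      rw [Int.cast_eq_zero.1 h, Int.cast_zero]
    rw [Int.cast_sum, Finset.sum_congr rfl fun i _ => hs' i] at h0
    simp [ZMod.natCast_eq_one_iff_odd.2 hodd] at h0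
  · exact h

/-- For odd `m ≥ 3` and a nonzero zero-sum tuple `λ`, the square of
`f(z) = ∑ i, λ i ‖z i‖²` is not of the form `h + c‖z‖⁴` with `h` harmonic. -/
theorem stmt6 (m : ℕ) (hodd : Odd m) (hm : 3 ≤ m) (lam : Fin m → ℝ)
    (hne : lam ≠ 0) (hsum : ∑ i, lam i = 0) :
    ¬ ∃ (h : EuclideanSpace ℂ (Fin m) → ℝ) (c : ℝ),
        ContDiff ℝ 2 h ∧ (∀ z, laplacianC m h z = 0) ∧
        ∀ z : EuclideanSpace ℂ (Fin m),
          (∑ i, lam i * ‖z i‖ ^ 2) ^ 2 = h z + c * ‖z‖ ^ 4 := by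
  rintro ⟨h, c, hC, hharm, heq⟩
  have hnorm : ∀ z : EuclideanSpace ℂ (Fin m), ‖z‖ ^ 4 = (∑ i, (1 : ℝ) * ‖z i‖ ^ 2) ^ 2 :=
    fun z => by simp only [one_mul, ← EuclideanSpace.norm_sq_eq]; ring
  have hdir : ∀ z d : EuclideanSpace ℂ (Fin m), dirDeriv2 h z d = _ := fun z d =>
    dirDeriv2_eq_of_quartic hC z d
      (∑ i, lam i * ‖z i‖ ^ 2) (2 * ∑ i, lam i * inner ℝ (z i) (d i)) (∑ i, lam i * ‖d i‖ ^ 2)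
      (∑ i, 1 * ‖z i‖ ^ 2) (2 * ∑ i, 1 * inner ℝ (z i) (d i)) (∑ i, 1 * ‖d i‖ ^ 2) c fun t => by
      rw [← sum_mul_norm_sq_add_smul lam z d t, ← sum_mul_norm_sq_add_smul (fun _ => 1) z d t,
        ← hnorm, heq, add_sub_cancel_right]
  refine hne (eq_zero_of_sq_eq_of_sum_eq_zero (by simpa using hodd)
    (a := c * (m + 1)) (fun k => ?_) hsum)
  have hlap := hharm (EuclideanSpace.single k 1)
  have hterm : ∀ j : Fin m,
      dirDeriv2 h (EuclideanSpace.single k 1) (EuclideanSpace.single j (1 : ℂ)) +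
        dirDeriv2 h (EuclideanSpace.single k 1) (EuclideanSpace.single j Complex.I) =
      8 * lam k * lam j - 8 * c + if j = k then 8 * (lam k ^ 2 - c) else 0 := fun j => by
    rw [hdir, hdir]
    by_cases hjk : j = k
    · subst hjk
      simp [apply_ite, ite_pow]
      ring
    · simp [apply_ite, ite_pow, hjk]
      ring
  simp only [laplacianC, hterm, Finset.sum_add_distrib, Finset.sum_sub_distrib, ← Finset.mul_sum,
    hsum, Finset.sum_ite_eq', Finset.mem_univ, if_true, Finset.sum_const, Finset.card_univ,
    Fintype.card_fin, nsmul_eq_mul] at hlap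
  linarith
end

section
/- Let S² denote the unit sphere in ℝ³ with its standard spherical measure σ, and equip S² × S² with the product measure σ ⊗ σ. Let v₁, v₂, w₁, w₂ : S² → ℝ be continuous functions that are odd under the antipodal map (vᵢ(−x) = −vᵢ(x), wᵢ(−x) = −wᵢ(x) for all x), and define v, w : S² × S² → ℝ by v(x, y) = v₁(x) + v₂(y) and w(x, y) = w₁(x) + w₂(y). Then ∫_{S²×S²} v(x,y)² * w(x,y) d(σ⊗σ)(x,y) = 0. -/
open MeasureTheory Metric

/-- The standard spherical (surface) measure on the unit sphere of `ℝ^d`,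
induced from the Lebesgue measure on `ℝ^d`. -/
noncomputable def sphereMeasure (d : ℕ) :
    Measure (sphere (0 : EuclideanSpace ℝ (Fin d)) 1) :=
  (volume : Measure (EuclideanSpace ℝ (Fin d))).toSphere

open scoped Pointwise in
/-- The spherical measure is invariant under the antipodal map. -/
theorem measurePreserving_neg_sphereMeasure (d : ℕ) :
    MeasurePreserving (fun x : sphere (0 : EuclideanSpace ℝ (Fin d)) 1 ↦ -x)
      (sphereMeasure d) (sphereMeasure d) := by
  have hm : Measurable (fun x : sphere (0 : EuclideanSpace ℝ (Fin d)) 1 ↦ -x) :=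
    continuous_neg.measurable
  refine ⟨hm, Measure.ext fun s hs ↦ ?_⟩
  have himage : ((↑) '' ((fun x : sphere (0 : EuclideanSpace ℝ (Fin d)) 1 ↦ -x) ⁻¹' s) :
      Set (EuclideanSpace ℝ (Fin d))) = -((↑) '' s) := by
    ext x
    simp only [Set.mem_image, Set.mem_preimage, Set.mem_neg]
    constructor
    · rintro ⟨y, hy, rfl⟩
      exact ⟨-y, hy, rfl⟩
    · rintro ⟨y, hy, hyx⟩
      exact ⟨-y, by simpa using hy, by simp [hyx]⟩
  rw [Measure.map_apply hm hs, sphereMeasure, Measure.toSphere_apply' _ (hm hs),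
    Measure.toSphere_apply' _ hs, himage, Set.smul_neg, Measure.measure_neg]

/-- A function that changes sign under a measure-preserving measurable embedding has zero
integral. -/
theorem MeasureTheory.MeasurePreserving.integral_eq_zero_of_comp_eq_neg {α : Type*}
    [MeasurableSpace α] {μ : Measure α} {g : α → α} (hg : MeasurePreserving g μ μ)
    (hge : MeasurableEmbedding g) {f : α → ℝ} (hf : ∀ x, f (g x) = -f x) :
    ∫ x, f x ∂μ = 0 := by
  have h := hg.integral_comp hge f
  simp only [hf, integral_neg] at h
  linarith

/-- For continuous odd functions `v₁, v₂, w₁, w₂` on `S²`, the functions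
`v(x,y) = v₁ x + v₂ y` and `w(x,y) = w₁ x + w₂ y` on `S² × S²` satisfy
`∫ v² w d(σ ⊗ σ) = 0`. -/
theorem stmt10 (v₁ v₂ w₁ w₂ : sphere (0 : EuclideanSpace ℝ (Fin 3)) 1 → ℝ)
    (hv₁ : Continuous v₁) (hv₂ : Continuous v₂)
    (hw₁ : Continuous w₁) (hw₂ : Continuous w₂)
    (hv₁odd : ∀ x, v₁ (-x) = -v₁ x) (hv₂odd : ∀ x, v₂ (-x) = -v₂ x)
    (hw₁odd : ∀ x, w₁ (-x) = -w₁ x) (hw₂odd : ∀ x, w₂ (-x) = -w₂ x) :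
    ∫ p : (sphere (0 : EuclideanSpace ℝ (Fin 3)) 1) ×
          (sphere (0 : EuclideanSpace ℝ (Fin 3)) 1),
      (v₁ p.1 + v₂ p.2) ^ 2 * (w₁ p.1 + w₂ p.2)
        ∂((sphereMeasure 3).prod (sphereMeasure 3)) = 0 := by
  have : IsFiniteMeasure (sphereMeasure 3) := by
    unfold sphereMeasure
    infer_instance
  have hneg := measurePreserving_neg_sphereMeasure 3
  refine (hneg.prod hneg).integral_eq_zero_of_comp_eq_neg
    ((Homeomorph.neg _).prodCongr (Homeomorph.neg _)).measurableEmbedding fun p ↦ ?_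
  simp only [Prod.map_fst, Prod.map_snd, hv₁odd, hv₂odd, hw₁odd, hw₂odd]
  ring
end
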